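/- arXiv:2412.02070 — 2 statements merged into one kernel-verified Lean document; each statement's English description precedes it below -/
import Mathlib

section
/- Let φ : ℝ → ℂ be a Schwartz function. Then there exist constants C > 0 and T > 0 such that for every t ∈ ℝ with |t| ≥ T and every x ∈ ℝ, one has |∫_ℝ exp(i(xξ + t·√(ξ²+1))) · φ(ξ) dξ| ≤ C · |t|^{-1/2}. -/
open MeasureTheory

namespace KleinGordon

/-- The group velocity `ξ / √(ξ² + 1)`, which is the derivative of `√(ξ² + 1)`. -/
noncomputable def velocity (ξ : ℝ) : ℝ := ξ / √(ξ ^ 2 + 1)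

lemma sqrt_sq_add_one_pos (ξ : ℝ) : 0 < √(ξ ^ 2 + 1) := Real.sqrt_pos.2 (by positivity)

lemma hasDerivAt_sqrt_sq_add_one (ξ : ℝ) :
    HasDerivAt (fun ξ : ℝ => √(ξ ^ 2 + 1)) (velocity ξ) ξ := by
  have h := (((hasDerivAt_id ξ).pow 2).add_const (1 : ℝ)).sqrt
    (by simp only [id, Pi.pow_apply]; positivity)
  refine h.congr_deriv ?_
  have := sqrt_sq_add_one_pos ξ
  simp [velocity]
  field_simp

lemma hasDerivAt_velocity (ξ : ℝ) : HasDerivAt velocity (√(ξ ^ 2 + 1) ^ 3)⁻¹ ξ := by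
  have hpos := sqrt_sq_add_one_pos ξ
  refine ((hasDerivAt_id ξ).div (hasDerivAt_sqrt_sq_add_one ξ) hpos.ne').congr_deriv ?_
  have hsq : √(ξ ^ 2 + 1) ^ 2 = ξ ^ 2 + 1 := Real.sq_sqrt (by positivity)
  simp only [velocity, id]
  field_simp
  linarith

lemma continuous_velocity : Continuous velocity :=
  continuous_iff_continuousAt.2 fun ξ => (hasDerivAt_velocity ξ).continuousAt

lemma continuous_inv_sqrt_cubed : Continuous fun ξ : ℝ => (√(ξ ^ 2 + 1) ^ 3)⁻¹ :=
  Continuous.inv₀ (by fun_prop) fun ξ => (pow_pos (sqrt_sq_add_one_pos ξ) 3).ne'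

lemma inv_sqrt_cubed_le (ξ : ℝ) : (√(ξ ^ 2 + 1) ^ 3)⁻¹ ≤ (1 + ξ ^ 2)⁻¹ := by
  have hsq : √(ξ ^ 2 + 1) ^ 2 = ξ ^ 2 + 1 := Real.sq_sqrt (by positivity)
  have h1 : 1 ≤ √(ξ ^ 2 + 1) := Real.one_le_sqrt.2 (by nlinarith [sq_nonneg ξ])
  gcongr
  calc 1 + ξ ^ 2 = √(ξ ^ 2 + 1) ^ 2 := by rw [hsq, add_comm]
    _ ≤ √(ξ ^ 2 + 1) ^ 3 := pow_le_pow_right₀ h1 (by norm_num)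

lemma inv_sqrt_cubed_le_one (ξ : ℝ) : (√(ξ ^ 2 + 1) ^ 3)⁻¹ ≤ 1 :=
  (inv_sqrt_cubed_le ξ).trans (inv_le_one_of_one_le₀ (by nlinarith [sq_nonneg ξ]))

lemma integrable_cauchy_weight {δ : ℝ} (hδ : 0 < δ) (c : ℝ) :
    Integrable fun ξ : ℝ =>
      (√(ξ ^ 2 + 1) ^ 3)⁻¹ * (δ ^ 2 / ((velocity ξ + c) ^ 2 + δ ^ 2)) := by
  refine integrable_inv_one_add_sq.mono' (Continuous.aestronglyMeasurable ?_)
    (Filter.Eventually.of_forall fun ξ => ?_)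
  · refine continuous_inv_sqrt_cubed.mul (Continuous.div (by fun_prop) ?_ fun ξ => by positivity)
    have := continuous_velocity
    fun_prop
  · have hpos := sqrt_sq_add_one_pos ξ
    rw [Real.norm_of_nonneg (by positivity)]
    refine (mul_le_of_le_one_right (by positivity) ?_).trans (inv_sqrt_cubed_le ξ)
    exact (div_le_one (by positivity)).2 (by nlinarith [sq_nonneg (velocity ξ + c)])

lemma integral_cauchy_weight_le {δ : ℝ} (hδ : 0 < δ) (c : ℝ) :
    ∫ ξ : ℝ, (√(ξ ^ 2 + 1) ^ 3)⁻¹ * (δ ^ 2 / ((velocity ξ + c) ^ 2 + δ ^ 2)) ≤ Real.pi * δ := by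
  have hint := integrable_cauchy_weight hδ c
  have hderiv : ∀ ξ : ℝ, HasDerivAt (fun ξ => δ * Real.arctan ((velocity ξ + c) / δ))
      ((√(ξ ^ 2 + 1) ^ 3)⁻¹ * (δ ^ 2 / ((velocity ξ + c) ^ 2 + δ ^ 2))) ξ := fun ξ => by
    refine (((((hasDerivAt_velocity ξ).add_const c).div_const δ).arctan).const_mul δ).congr_deriv ?_
    have := sqrt_sq_add_one_pos ξ
    field_simp
    ring
  refine le_of_tendsto' (intervalIntegral_tendsto_integral hint
    Filter.tendsto_neg_atTop_atBot Filter.tendsto_id) fun R => ?_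
  rw [intervalIntegral.integral_eq_sub_of_hasDerivAt (fun ξ _ => hderiv ξ)
    hint.intervalIntegrable]
  nlinarith [Real.arctan_lt_pi_div_two ((velocity (id R) + c) / δ),
    Real.neg_pi_div_two_lt_arctan ((velocity (-R) + c) / δ)]

lemma exists_norm_le_inv_sqrt_cubed (φ : SchwartzMap ℝ ℂ) :
    ∃ K : ℝ, 0 ≤ K ∧ ∀ ξ, ‖φ ξ‖ ≤ K * (√(ξ ^ 2 + 1) ^ 3)⁻¹ := by
  obtain ⟨K, hK⟩ : ∃ K : ℝ, ∀ ξ, (1 + ‖ξ‖) ^ 3 * ‖φ ξ‖ ≤ K :=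
    ⟨_, fun ξ => by
      simpa using SchwartzMap.one_add_le_sup_seminorm_apply (𝕜 := ℝ) (m := (3, 0)) le_rfl le_rfl φ ξ⟩
  refine ⟨K, le_trans (by positivity) (hK 0), fun ξ => ?_⟩
  have hpos := sqrt_sq_add_one_pos ξ
  rw [← div_eq_mul_inv, le_div_iff₀ (by positivity), mul_comm]
  refine le_trans ?_ (hK ξ)
  have : √(ξ ^ 2 + 1) ≤ 1 + ‖ξ‖ := Real.sqrt_le_iff.2
    ⟨by positivity, by rw [Real.norm_eq_abs]; nlinarith [sq_abs ξ, abs_nonneg ξ]⟩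
  gcongr

lemma hasDerivAt_div_sq_add_sq {δ : ℝ} (hδ : 0 < δ) (q : ℝ) :
    HasDerivAt (fun q : ℝ => q / (q ^ 2 + δ ^ 2))
      ((δ ^ 2 - q ^ 2) / (q ^ 2 + δ ^ 2) ^ 2) q := by
  refine ((hasDerivAt_id q).div (((hasDerivAt_id q).pow 2).add_const (δ ^ 2))
    (by simp only [id, Pi.pow_apply]; positivity)).congr_deriv ?_
  simp
  ring

lemma abs_div_sq_add_sq_le {δ : ℝ} (hδ : 0 < δ) (q : ℝ) :
    |q / (q ^ 2 + δ ^ 2)| ≤ 1 / δ := by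
  rw [abs_div, abs_of_pos (by positivity : 0 < q ^ 2 + δ ^ 2),
    div_le_div_iff₀ (by positivity) hδ]
  nlinarith [sq_nonneg (|q| - δ), sq_abs q, abs_nonneg q]

lemma abs_deriv_div_sq_add_sq_le {δ : ℝ} (hδ : 0 < δ) (q : ℝ) :
    |(δ ^ 2 - q ^ 2) / (q ^ 2 + δ ^ 2) ^ 2| ≤ 1 / (q ^ 2 + δ ^ 2) := by
  rw [abs_div, abs_of_pos (by positivity : 0 < (q ^ 2 + δ ^ 2) ^ 2),
    div_le_div_iff₀ (by positivity) (by positivity), one_mul, sq (q ^ 2 + δ ^ 2)]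
  gcongr
  exact abs_le.2 ⟨by nlinarith [sq_nonneg q, sq_nonneg δ], by nlinarith [sq_nonneg q, sq_nonneg δ]⟩

/-- The oscillating factor of the Klein–Gordon propagator. -/
noncomputable def wave (t x ξ : ℝ) : ℂ :=
  Complex.exp (Complex.I * ((x * ξ + t * √(ξ ^ 2 + 1) : ℝ) : ℂ))

lemma norm_wave (t x ξ : ℝ) : ‖wave t x ξ‖ = 1 := by
  rw [wave, mul_comm, Complex.norm_exp_ofReal_mul_I]

lemma continuous_wave (t x : ℝ) : Continuous (wave t x) := by
  unfold wave
  fun_prop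

lemma hasDerivAt_wave {t : ℝ} (ht : t ≠ 0) (x ξ : ℝ) :
    HasDerivAt (wave t x) (wave t x ξ * (Complex.I * t * (velocity ξ + x / t : ℝ))) ξ := by
  have h := ((((hasDerivAt_id ξ).const_mul x).add
    ((hasDerivAt_sqrt_sq_add_one ξ).const_mul t)).ofReal_comp.const_mul Complex.I).cexp
  refine h.congr_deriv ?_
  have ht' : (t : ℂ) ≠ 0 := by exact_mod_cast ht
  simp only [wave, id, Pi.add_apply]
  push_cast
  field_simp
  ring

/-- What remains of `wave t x ξ * φ ξ` after subtracting `(I * t)⁻¹` times the derivative of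
`wave t x ξ * (q / (q² + δ²)) * φ ξ`, where `q = velocity ξ + x / t`. -/
noncomputable def remainder (φ : SchwartzMap ℝ ℂ) (δ t x ξ : ℝ) : ℂ :=
  wave t x ξ * (((δ ^ 2 / ((velocity ξ + x / t) ^ 2 + δ ^ 2) : ℝ) : ℂ) * φ ξ
    - (Complex.I * t)⁻¹ *
      ((((δ ^ 2 - (velocity ξ + x / t) ^ 2) / ((velocity ξ + x / t) ^ 2 + δ ^ 2) ^ 2
        * (√(ξ ^ 2 + 1) ^ 3)⁻¹ : ℝ) : ℂ) * φ ξ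
      + (((velocity ξ + x / t) / ((velocity ξ + x / t) ^ 2 + δ ^ 2) : ℝ) : ℂ) * deriv φ ξ))

lemma continuous_remainder (φ : SchwartzMap ℝ ℂ) {δ : ℝ} (hδ : 0 < δ) (t x : ℝ) :
    Continuous (remainder φ δ t x) := by
  have h1 := continuous_velocity
  have h2 := continuous_wave t x
  have h3 := continuous_inv_sqrt_cubed
  have h4 : Continuous (deriv φ) := (SchwartzMap.derivCLM ℝ ℂ φ).continuous
  have h5 := φ.continuous
  have h6 : Continuous fun ξ => δ ^ 2 / ((velocity ξ + x / t) ^ 2 + δ ^ 2) :=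
    Continuous.div (by fun_prop) (by fun_prop) fun ξ => by positivity
  have h7 : Continuous fun ξ => (δ ^ 2 - (velocity ξ + x / t) ^ 2) /
      ((velocity ξ + x / t) ^ 2 + δ ^ 2) ^ 2 :=
    Continuous.div (by fun_prop) (by fun_prop) fun ξ => by positivity
  have h8 : Continuous fun ξ => (velocity ξ + x / t) / ((velocity ξ + x / t) ^ 2 + δ ^ 2) :=
    Continuous.div (by fun_prop) (by fun_prop) fun ξ => by positivity
  exact h2.mul (((Complex.continuous_ofReal.comp h6).mul h5).sub (continuous_const.mul
    (((Complex.continuous_ofReal.comp (h7.mul h3)).mul h5).add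
      ((Complex.continuous_ofReal.comp h8).mul h4))))

lemma hasDerivAt_wave_mul (φ : SchwartzMap ℝ ℂ) {δ t : ℝ} (hδ : 0 < δ) (ht : t ≠ 0) (x ξ : ℝ) :
    HasDerivAt (fun ξ => wave t x ξ *
        ((((velocity ξ + x / t) / ((velocity ξ + x / t) ^ 2 + δ ^ 2) : ℝ) : ℂ) * φ ξ))
      (Complex.I * t * (wave t x ξ * φ ξ - remainder φ δ t x ξ)) ξ := by
  have hh := ((hasDerivAt_div_sq_add_sq hδ (velocity ξ + x / t)).comp ξ
    ((hasDerivAt_velocity ξ).add_const (x / t))).ofReal_comp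
  refine ((hasDerivAt_wave ht x ξ).mul
    (hh.mul φ.differentiableAt.hasDerivAt)).congr_deriv ?_
  have ht' : (t : ℂ) ≠ 0 := by exact_mod_cast ht
  simp only [remainder, Function.comp_apply, Pi.mul_apply]
  generalize (√(ξ ^ 2 + 1) ^ 3)⁻¹ = p'
  generalize velocity ξ + x / t = q
  have hsplit : ((δ ^ 2 / (q ^ 2 + δ ^ 2) : ℝ) : ℂ) =
      1 - (q : ℂ) * ((q / (q ^ 2 + δ ^ 2) : ℝ) : ℂ) := by
    rw [← Complex.ofReal_mul, ← Complex.ofReal_one, ← Complex.ofReal_sub]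
    congr 1
    field_simp
    ring
  rw [hsplit]
  generalize (δ ^ 2 - q ^ 2) / (q ^ 2 + δ ^ 2) ^ 2 = h'
  generalize q / (q ^ 2 + δ ^ 2) = h
  have hI := Complex.I_ne_zero
  push_cast
  field_simp
  ring

lemma norm_remainder_le (φ : SchwartzMap ℝ ℂ) {K δ t : ℝ} (hδ : 0 < δ)
    (hδt : δ ^ 2 = |t|⁻¹) (hK : ∀ ξ, ‖φ ξ‖ ≤ K * (√(ξ ^ 2 + 1) ^ 3)⁻¹) (x ξ : ℝ) :
    ‖remainder φ δ t x ξ‖ ≤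
      2 * K * ((√(ξ ^ 2 + 1) ^ 3)⁻¹ * (δ ^ 2 / ((velocity ξ + x / t) ^ 2 + δ ^ 2)))
        + δ * ‖deriv φ ξ‖ := by
  have hφ := hK ξ
  have hp' : 0 < (√(ξ ^ 2 + 1) ^ 3)⁻¹ := inv_pos.2 (pow_pos (sqrt_sq_add_one_pos ξ) 3)
  have hp1 := inv_sqrt_cubed_le_one ξ
  have hIt : ‖(Complex.I * (t : ℂ))⁻¹‖ = δ ^ 2 := by simp [hδt]
  rw [remainder, norm_mul, norm_wave, one_mul]
  generalize (√(ξ ^ 2 + 1) ^ 3)⁻¹ = p' at *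
  generalize velocity ξ + x / t = q
  have h1 := abs_div_sq_add_sq_le hδ q
  have h2 := abs_deriv_div_sq_add_sq_le hδ q
  have hw : 0 < δ ^ 2 / (q ^ 2 + δ ^ 2) := by positivity
  have hA : ‖((δ ^ 2 / (q ^ 2 + δ ^ 2) : ℝ) : ℂ) * φ ξ‖ ≤ K * (p' * (δ ^ 2 / (q ^ 2 + δ ^ 2))) := by
    rw [norm_mul, Complex.norm_real, Real.norm_of_nonneg hw.le]
    calc _ ≤ δ ^ 2 / (q ^ 2 + δ ^ 2) * (K * p') := by gcongr
      _ = _ := by ring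
  have hB : ‖(((δ ^ 2 - q ^ 2) / (q ^ 2 + δ ^ 2) ^ 2 * p' : ℝ) : ℂ) * φ ξ‖ ≤
      1 / (q ^ 2 + δ ^ 2) * (K * p') := by
    rw [norm_mul, Complex.norm_real, Real.norm_eq_abs, abs_mul, abs_of_pos hp']
    gcongr
    exact (mul_le_of_le_one_right (abs_nonneg _) hp1).trans h2
  have hC : ‖((q / (q ^ 2 + δ ^ 2) : ℝ) : ℂ) * deriv φ ξ‖ ≤ 1 / δ * ‖deriv φ ξ‖ := by
    rw [norm_mul, Complex.norm_real, Real.norm_eq_abs]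
    gcongr
  refine (norm_sub_le _ _).trans ?_
  rw [norm_mul (Complex.I * (t : ℂ))⁻¹, hIt]
  calc _ ≤ K * (p' * (δ ^ 2 / (q ^ 2 + δ ^ 2))) +
        δ ^ 2 * (1 / (q ^ 2 + δ ^ 2) * (K * p') + 1 / δ * ‖deriv φ ξ‖) := by
        gcongr
        exact (norm_add_le _ _).trans (add_le_add hB hC)
    _ = _ := by
        field_simp
        ring

lemma integrable_wave_mul (φ : SchwartzMap ℝ ℂ) (t x : ℝ) :
    Integrable fun ξ => wave t x ξ * φ ξ :=
  φ.integrable.bdd_mul (continuous_wave t x).aestronglyMeasurable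
    (Filter.Eventually.of_forall fun ξ => (norm_wave t x ξ).le)

lemma norm_integral_wave_mul_le (φ : SchwartzMap ℝ ℂ) {K δ t : ℝ} (hK0 : 0 ≤ K) (hδ : 0 < δ)
    (ht : t ≠ 0) (hδt : δ ^ 2 = |t|⁻¹) (hK : ∀ ξ, ‖φ ξ‖ ≤ K * (√(ξ ^ 2 + 1) ^ 3)⁻¹) (x : ℝ) :
    ‖∫ ξ, wave t x ξ * φ ξ‖ ≤ (2 * K * Real.pi + ∫ ξ, ‖deriv φ ξ‖) * δ := by
  have hderiv : Integrable fun ξ => ‖deriv φ ξ‖ := (SchwartzMap.derivCLM ℝ ℂ φ).integrable.norm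
  have hweight := (integrable_cauchy_weight hδ (x / t)).const_mul (2 * K)
  have hbound := hweight.add (hderiv.const_mul δ)
  have hle := norm_remainder_le φ hδ hδt hK x
  have hR : Integrable (remainder φ δ t x) :=
    hbound.mono' (continuous_remainder φ hδ t x).aestronglyMeasurable (.of_forall hle)
  have hwave := integrable_wave_mul φ t x
  have hF : Integrable fun ξ => wave t x ξ *
      ((((velocity ξ + x / t) / ((velocity ξ + x / t) ^ 2 + δ ^ 2) : ℝ) : ℂ) * φ ξ) := by
    refine (φ.integrable.norm.const_mul (1 / δ)).mono'
      (continuous_iff_continuousAt.2 fun ξ =>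
        (hasDerivAt_wave_mul φ hδ ht x ξ).continuousAt).aestronglyMeasurable
      (.of_forall fun ξ => ?_)
    rw [norm_mul, norm_wave, one_mul, norm_mul, Complex.norm_real]
    gcongr
    exact abs_div_sq_add_sq_le hδ _
  have hzero := integral_eq_zero_of_hasDerivAt_of_integrable (hasDerivAt_wave_mul φ hδ ht x)
    ((hwave.sub hR).const_mul _) hF
  have hIt : Complex.I * (t : ℂ) ≠ 0 := mul_ne_zero Complex.I_ne_zero (by exact_mod_cast ht)
  rw [integral_const_mul, mul_eq_zero, or_iff_right hIt, integral_sub hwave hR,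
    sub_eq_zero] at hzero
  rw [hzero]
  refine (norm_integral_le_of_norm_le hbound (.of_forall hle)).trans ?_
  simp only [Pi.add_apply]
  rw [integral_add hweight (hderiv.const_mul δ), integral_const_mul, integral_const_mul]
  nlinarith [mul_le_mul_of_nonneg_left (integral_cauchy_weight_le hδ (x / t)) hK0]

end KleinGordon

/-- Dispersive decay of the one-dimensional Klein–Gordon
oscillatory integral: for a Schwartz function `φ`, the integral
`∫ e^{i(xξ + t√(ξ²+1))} φ(ξ) dξ` is bounded by `C |t|^{-1/2}` for all large `|t|`,
uniformly in `x`. -/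
theorem stmt7 (φ : SchwartzMap ℝ ℂ) :
    ∃ C : ℝ, 0 < C ∧ ∃ T : ℝ, 0 < T ∧
      ∀ t x : ℝ, T ≤ |t| →
        ‖∫ ξ : ℝ, Complex.exp (Complex.I *
            ((x * ξ + t * Real.sqrt (ξ ^ 2 + 1) : ℝ) : ℂ)) * φ ξ‖
          ≤ C * |t| ^ (-(1 : ℝ) / 2) := by
  obtain ⟨K, hK0, hK⟩ := KleinGordon.exists_norm_le_inv_sqrt_cubed φ
  have hC : 0 ≤ 2 * K * Real.pi + ∫ ξ, ‖deriv φ ξ‖ :=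
    add_nonneg (by positivity) (integral_nonneg fun _ => norm_nonneg _)
  refine ⟨2 * K * Real.pi + (∫ ξ, ‖deriv φ ξ‖) + 1, by linarith, 1, one_pos, fun t x ht => ?_⟩
  have ht0 : 0 < |t| := by linarith
  have hδ : 0 < |t| ^ (-(1 : ℝ) / 2) := Real.rpow_pos_of_pos ht0 _
  have hδt : (|t| ^ (-(1 : ℝ) / 2)) ^ 2 = |t|⁻¹ := by
    rw [← Real.rpow_natCast, ← Real.rpow_mul ht0.le, ← Real.rpow_neg_one]
    norm_num
  refine (KleinGordon.norm_integral_wave_mul_le φ hK0 hδ (abs_pos.1 ht0) hδt hK x).trans ?_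
  exact mul_le_mul_of_nonneg_right (by linarith) hδ.le
end

section
/- Let Φ(r) := Σ_{k=1}^∞ r^k / (k·((k-1)!)²). Then: (i) for every r > 0 the integral ∫_r^∞ Φ(s)^{-2} ds is finite, so that Ψ(r) := Φ(r) · ∫_r^∞ Φ(s)^{-2} ds is well defined on (0,∞); (ii) Ψ is twice differentiable on (0,∞) and satisfies Ψ''(r) = Ψ(r)/r for all r > 0; (iii) Ψ(r) converges to a positive real limit as r → 0⁺; and (iv) for every N > 0 there exists a constant C > 0 such that Ψ(r) ≤ C·r^{-N} and |Ψ'(r)| ≤ C·r^{-N} for all r ≥ 1. -/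
open MeasureTheory

/-- `Φ(r) = Σ_{k≥1} r^k/(k·((k-1)!)²)`, reindexed as a sum over `k : ℕ` of
`r^{k+1}/((k+1)·(k!)²)`. -/
noncomputable def Phi (r : ℝ) : ℝ :=
  ∑' k : ℕ, r ^ (k + 1) / (((k : ℝ) + 1) * ((Nat.factorial k : ℝ)) ^ 2)

/-- `Ψ(r) = Φ(r) · ∫_r^∞ Φ(s)^{-2} ds`, the second solution of `w'' = w/r`. -/
noncomputable def Psi (r : ℝ) : ℝ :=
  Phi r * ∫ s in Set.Ioi r, ((Phi s) ^ 2)⁻¹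

/-- The termwise derivative of `Phi`. -/
noncomputable def PhiDeriv (r : ℝ) : ℝ :=
  ∑' k : ℕ, r ^ k / ((Nat.factorial k : ℝ)) ^ 2

lemma one_le_factorial_cast (k : ℕ) : (1 : ℝ) ≤ (Nat.factorial k : ℝ) := by
  exact_mod_cast Nat.factorial_pos k

lemma abs_pow_div_factorial_sq_le (r : ℝ) (k : ℕ) :
    ‖r ^ k / ((Nat.factorial k : ℝ)) ^ 2‖ ≤ |r| ^ k / (Nat.factorial k : ℝ) := by
  have h := one_le_factorial_cast k
  rw [Real.norm_eq_abs, abs_div, abs_pow, abs_of_pos (by positivity : (0 : ℝ) < _ ^ 2)]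
  gcongr
  nlinarith

lemma summable_pow_div_factorial_sq (r : ℝ) :
    Summable fun k : ℕ => r ^ k / ((Nat.factorial k : ℝ)) ^ 2 :=
  .of_norm_bounded (Real.summable_pow_div_factorial |r|) (abs_pow_div_factorial_sq_le r)

lemma summable_pow_div_succ_mul_factorial_sq (r : ℝ) :
    Summable fun k : ℕ => r ^ k / (((k : ℝ) + 1) * ((Nat.factorial k : ℝ)) ^ 2) := by
  refine .of_norm_bounded (summable_pow_div_factorial_sq r).norm fun k => ?_
  have h := one_le_factorial_cast k
  simp only [Real.norm_eq_abs, abs_div]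
  gcongr
  have : (0 : ℝ) ≤ k * ((Nat.factorial k : ℝ)) ^ 2 := by positivity
  linarith

lemma Phi_term_eq (r : ℝ) (k : ℕ) :
    r ^ (k + 1) / (((k : ℝ) + 1) * ((Nat.factorial k : ℝ)) ^ 2) =
      r * (r ^ k / (((k : ℝ) + 1) * ((Nat.factorial k : ℝ)) ^ 2)) := by
  rw [pow_succ']; ring

lemma Phi_eq_mul (r : ℝ) :
    Phi r = r * ∑' k : ℕ, r ^ k / (((k : ℝ) + 1) * ((Nat.factorial k : ℝ)) ^ 2) := by
  rw [Phi, ← tsum_mul_left]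
  exact tsum_congr (Phi_term_eq r)

lemma summable_Phi (r : ℝ) :
    Summable fun k : ℕ => r ^ (k + 1) / (((k : ℝ) + 1) * ((Nat.factorial k : ℝ)) ^ 2) :=
  ((summable_pow_div_succ_mul_factorial_sq r).mul_left r).congr fun k => (Phi_term_eq r k).symm

lemma hasDerivAt_Phi (r : ℝ) : HasDerivAt Phi (PhiDeriv r) r := by
  refine hasDerivAt_tsum_of_isPreconnected
    (g := fun (k : ℕ) (y : ℝ) => y ^ (k + 1) / (((k : ℝ) + 1) * ((Nat.factorial k : ℝ)) ^ 2))
    (g' := fun (k : ℕ) (y : ℝ) => y ^ k / ((Nat.factorial k : ℝ)) ^ 2)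
    (t := Metric.ball (0 : ℝ) (|r| + 1)) (y₀ := r)
    (Real.summable_pow_div_factorial (|r| + 1)) Metric.isOpen_ball
    (convex_ball _ _).isPreconnected (fun k y _ => ?_) (fun k y hy => ?_) (by simp)
    (summable_Phi r) (by simp)
  · have h := (hasDerivAt_pow (k + 1) y).div_const
      (((k : ℝ) + 1) * ((Nat.factorial k : ℝ)) ^ 2)
    refine h.congr_deriv ?_
    rw [Nat.add_sub_cancel, Nat.cast_succ, mul_div_mul_left _ _ k.cast_add_one_ne_zero]
  · have hy' : |y| ≤ |r| + 1 := by simpa using (mem_ball_zero_iff.1 hy).le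
    refine (abs_pow_div_factorial_sq_le y k).trans ?_
    gcongr

lemma succ_mul_pow_div_factorial_sq (r : ℝ) (k : ℕ) :
    ((k + 1 : ℕ) : ℝ) * r ^ (k + 1 - 1) / ((Nat.factorial (k + 1) : ℝ)) ^ 2 =
      r ^ k / (((k : ℝ) + 1) * ((Nat.factorial k : ℝ)) ^ 2) := by
  rw [Nat.factorial_succ]
  push_cast
  field_simp

lemma hasDerivAt_PhiDeriv {r : ℝ} (hr : r ≠ 0) : HasDerivAt PhiDeriv (Phi r / r) r := by
  have hsum : Phi r / r = ∑' k : ℕ, (k : ℝ) * r ^ (k - 1) / ((Nat.factorial k : ℝ)) ^ 2 := by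
    have hs : Summable fun k : ℕ => (k : ℝ) * r ^ (k - 1) / ((Nat.factorial k : ℝ)) ^ 2 := by
      rw [← summable_nat_add_iff 1]
      exact (summable_pow_div_succ_mul_factorial_sq r).congr
        fun k => (succ_mul_pow_div_factorial_sq r k).symm
    rw [hs.tsum_eq_zero_add, tsum_congr (succ_mul_pow_div_factorial_sq r), Phi_eq_mul]
    simp [hr]
  rw [hsum]
  refine hasDerivAt_tsum_of_isPreconnected
    (g := fun (k : ℕ) (y : ℝ) => y ^ k / ((Nat.factorial k : ℝ)) ^ 2)
    (g' := fun (k : ℕ) (y : ℝ) => (k : ℝ) * y ^ (k - 1) / ((Nat.factorial k : ℝ)) ^ 2)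
    (t := Metric.ball (0 : ℝ) (|r| + 1)) (y₀ := r)
    (Real.summable_pow_div_factorial (|r| + 1)) Metric.isOpen_ball
    (convex_ball _ _).isPreconnected (fun k y _ => ?_) (fun k y hy => ?_) (by simp)
    (summable_pow_div_factorial_sq r) (by simp)
  · exact (hasDerivAt_pow k y).div_const _
  · have hy' : |y| ≤ |r| + 1 := by simpa using (mem_ball_zero_iff.1 hy).le
    have hk : (k : ℝ) ≤ Nat.factorial k := by exact_mod_cast Nat.self_le_factorial k
    rw [Real.norm_eq_abs, abs_div, abs_mul, abs_pow, Nat.abs_cast,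
      abs_of_pos (by positivity : (0 : ℝ) < _ ^ 2)]
    have hpow : |y| ^ (k - 1) ≤ (|r| + 1) ^ k :=
      (pow_le_pow_left₀ (abs_nonneg y) hy' _).trans
        (pow_le_pow_right₀ (by linarith [abs_nonneg r]) (Nat.sub_le k 1))
    calc (k : ℝ) * |y| ^ (k - 1) / (Nat.factorial k : ℝ) ^ 2
        ≤ (Nat.factorial k : ℝ) * (|r| + 1) ^ k / (Nat.factorial k : ℝ) ^ 2 := by gcongr
      _ = (|r| + 1) ^ k / (Nat.factorial k : ℝ) := by field_simp

lemma le_Phi {r : ℝ} (hr : 0 ≤ r) (n : ℕ) :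
    r ^ (n + 1) / (((n : ℝ) + 1) * ((Nat.factorial n : ℝ)) ^ 2) ≤ Phi r :=
  (summable_Phi r).le_tsum n fun _ _ => by positivity

lemma le_PhiDeriv {r : ℝ} (hr : 0 ≤ r) (n : ℕ) :
    r ^ n / ((Nat.factorial n : ℝ)) ^ 2 ≤ PhiDeriv r :=
  (summable_pow_div_factorial_sq r).le_tsum n fun _ _ => by positivity

lemma self_le_Phi {r : ℝ} (hr : 0 ≤ r) : r ≤ Phi r := by simpa using le_Phi hr 0

lemma one_le_PhiDeriv {r : ℝ} (hr : 0 ≤ r) : 1 ≤ PhiDeriv r := by simpa using le_PhiDeriv hr 0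

lemma Phi_pos {r : ℝ} (hr : 0 < r) : 0 < Phi r := hr.trans_le (self_le_Phi hr.le)

lemma PhiDeriv_le_PhiDeriv {r s : ℝ} (hr : 0 ≤ r) (hrs : r ≤ s) : PhiDeriv r ≤ PhiDeriv s :=
  (summable_pow_div_factorial_sq r).tsum_le_tsum (fun _ => by gcongr)
    (summable_pow_div_factorial_sq s)

lemma continuous_Phi : Continuous Phi :=
  continuous_iff_continuousAt.2 fun r => (hasDerivAt_Phi r).continuousAt

lemma continuousAt_inv_Phi_sq {r : ℝ} (hr : 0 < r) :
    ContinuousAt (fun s => ((Phi s) ^ 2)⁻¹) r :=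
  (continuous_Phi.continuousAt.pow 2).inv₀ (pow_ne_zero 2 (Phi_pos hr).ne')

lemma hasDerivAt_neg_inv_Phi {r : ℝ} (hr : 0 < r) :
    HasDerivAt (fun s => -(Phi s)⁻¹) (PhiDeriv r * ((Phi r) ^ 2)⁻¹) r := by
  refine ((hasDerivAt_Phi r).fun_inv (Phi_pos hr).ne').fun_neg.congr_deriv ?_
  ring

lemma PhiDeriv_mul_inv_Phi_sq_nonneg {r : ℝ} (hr : 0 < r) :
    0 ≤ PhiDeriv r * ((Phi r) ^ 2)⁻¹ :=
  mul_nonneg (zero_le_one.trans (one_le_PhiDeriv hr.le)) (by positivity)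

lemma tendsto_neg_inv_Phi_atTop :
    Filter.Tendsto (fun s => -(Phi s)⁻¹) Filter.atTop (nhds 0) := by
  have h : Filter.Tendsto Phi Filter.atTop Filter.atTop :=
    Filter.tendsto_atTop_mono' _
      ((Filter.eventually_ge_atTop 0).mono fun _ => self_le_Phi) Filter.tendsto_id
  simpa using h.inv_tendsto_atTop.neg

lemma integrableOn_PhiDeriv_mul_inv_Phi_sq {r : ℝ} (hr : 0 < r) :
    IntegrableOn (fun s => PhiDeriv s * ((Phi s) ^ 2)⁻¹) (Set.Ioi r) :=
  integrableOn_Ioi_deriv_of_nonneg' (fun _ hx => hasDerivAt_neg_inv_Phi (hr.trans_le hx))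
    (fun _ hx => PhiDeriv_mul_inv_Phi_sq_nonneg (hr.trans hx)) tendsto_neg_inv_Phi_atTop

lemma integral_PhiDeriv_mul_inv_Phi_sq {r : ℝ} (hr : 0 < r) :
    ∫ s in Set.Ioi r, PhiDeriv s * ((Phi s) ^ 2)⁻¹ = (Phi r)⁻¹ := by
  rw [integral_Ioi_of_hasDerivAt_of_nonneg'
    (fun _ hx => hasDerivAt_neg_inv_Phi (hr.trans_le hx))
    (fun _ hx => PhiDeriv_mul_inv_Phi_sq_nonneg (hr.trans hx)) tendsto_neg_inv_Phi_atTop]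
  ring

lemma integrableOn_inv_Phi_sq {r : ℝ} (hr : 0 < r) :
    IntegrableOn (fun s => ((Phi s) ^ 2)⁻¹) (Set.Ioi r) := by
  refine (integrableOn_PhiDeriv_mul_inv_Phi_sq hr).mono' ?_ ?_
  · exact ContinuousOn.aestronglyMeasurable
      (fun s hs => (continuousAt_inv_Phi_sq (hr.trans hs)).continuousWithinAt) measurableSet_Ioi
  · refine (ae_restrict_iff' measurableSet_Ioi).2 (.of_forall fun s hs => ?_)
    rw [Real.norm_of_nonneg (by positivity)]
    exact le_mul_of_one_le_left (by positivity) (one_le_PhiDeriv (hr.trans hs).le)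

lemma integral_inv_Phi_sq_pos {r : ℝ} (hr : 0 < r) :
    0 < ∫ s in Set.Ioi r, ((Phi s) ^ 2)⁻¹ := by
  rw [setIntegral_pos_iff_support_of_nonneg_ae (.of_forall fun s => by positivity)
    (integrableOn_inv_Phi_sq hr), Set.inter_eq_right.2 fun s hs => ?_]
  · simp
  · exact inv_ne_zero (pow_ne_zero 2 (Phi_pos (hr.trans hs)).ne')

lemma PhiDeriv_mul_integral_le {r : ℝ} (hr : 0 < r) :
    PhiDeriv r * ∫ s in Set.Ioi r, ((Phi s) ^ 2)⁻¹ ≤ (Phi r)⁻¹ := by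
  rw [← integral_PhiDeriv_mul_inv_Phi_sq hr, ← integral_const_mul]
  refine setIntegral_mono_on ((integrableOn_inv_Phi_sq hr).const_mul _)
    (integrableOn_PhiDeriv_mul_inv_Phi_sq hr) measurableSet_Ioi fun s hs => ?_
  exact mul_le_mul_of_nonneg_right (PhiDeriv_le_PhiDeriv hr.le (le_of_lt hs)) (by positivity)

lemma hasDerivAt_integral_inv_Phi_sq {r : ℝ} (hr : 0 < r) :
    HasDerivAt (fun x => ∫ s in Set.Ioi x, ((Phi s) ^ 2)⁻¹) (-((Phi r) ^ 2)⁻¹) r := by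
  have hcont : ∀ x ∈ Set.Ioi (0 : ℝ), ContinuousAt (fun s => ((Phi s) ^ 2)⁻¹) x :=
    fun _ hx => continuousAt_inv_Phi_sq hx
  have h : HasDerivAt (fun x => ∫ s in r..x, ((Phi s) ^ 2)⁻¹) (((Phi r) ^ 2)⁻¹) r :=
    intervalIntegral.integral_hasDerivAt_right (by simp)
      (ContinuousAt.stronglyMeasurableAtFilter isOpen_Ioi hcont r hr) (hcont r hr)
  refine (h.const_sub (∫ s in Set.Ioi r, ((Phi s) ^ 2)⁻¹)).congr_of_eventuallyEq ?_
  filter_upwards [Ioi_mem_nhds hr] with x hx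
  rw [← intervalIntegral.integral_Ioi_sub_Ioi' (integrableOn_inv_Phi_sq hr)
    (integrableOn_inv_Phi_sq hx)]
  ring

lemma hasDerivAt_Psi {r : ℝ} (hr : 0 < r) :
    HasDerivAt Psi (PhiDeriv r * (∫ s in Set.Ioi r, ((Phi s) ^ 2)⁻¹) - (Phi r)⁻¹) r := by
  refine ((hasDerivAt_Phi r).fun_mul (hasDerivAt_integral_inv_Phi_sq hr)).congr_deriv ?_
  have := (Phi_pos hr).ne'
  field_simp
  ring

lemma hasDerivAt_deriv_Psi {r : ℝ} (hr : 0 < r) : HasDerivAt (deriv Psi) (Psi r / r) r := by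
  have h := ((hasDerivAt_PhiDeriv hr.ne').fun_mul (hasDerivAt_integral_inv_Phi_sq hr)).fun_add
    (hasDerivAt_neg_inv_Phi hr)
  refine (h.congr_deriv ?_).congr_of_eventuallyEq ?_
  · rw [Psi]; ring
  · filter_upwards [Ioi_mem_nhds hr] with x hx
    rw [(hasDerivAt_Psi hx).deriv, sub_eq_add_neg]

lemma Psi_pos {r : ℝ} (hr : 0 < r) : 0 < Psi r :=
  mul_pos (Phi_pos hr) (integral_inv_Phi_sq_pos hr)

lemma Psi_le_inv_PhiDeriv {r : ℝ} (hr : 0 < r) : Psi r ≤ (PhiDeriv r)⁻¹ := by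
  have hD : 0 < PhiDeriv r := zero_lt_one.trans_le (one_le_PhiDeriv hr.le)
  have h := mul_le_mul_of_nonneg_left (PhiDeriv_mul_integral_le hr) (Phi_pos hr).le
  rw [mul_inv_cancel₀ (Phi_pos hr).ne'] at h
  rw [← one_div, le_div_iff₀ hD, Psi]
  linarith

lemma deriv_Psi_nonpos {r : ℝ} (hr : 0 < r) : deriv Psi r ≤ 0 := by
  rw [(hasDerivAt_Psi hr).deriv]
  exact sub_nonpos.2 (PhiDeriv_mul_integral_le hr)

lemma abs_deriv_Psi_le {r : ℝ} (hr : 0 < r) : |deriv Psi r| ≤ (Phi r)⁻¹ := by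
  rw [abs_of_nonpos (deriv_Psi_nonpos hr), (hasDerivAt_Psi hr).deriv, neg_sub]
  exact sub_le_self _ (mul_nonneg (zero_le_one.trans (one_le_PhiDeriv hr.le))
    (integral_inv_Phi_sq_pos hr).le)

lemma antitoneOn_Psi : AntitoneOn Psi (Set.Ioi 0) := by
  refine antitoneOn_of_deriv_nonpos (convex_Ioi 0)
    (fun r hr => (hasDerivAt_Psi hr).continuousAt.continuousWithinAt) ?_ ?_ <;>
  rw [interior_Ioi]
  · exact fun r hr => (hasDerivAt_Psi hr).differentiableAt.differentiableWithinAt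
  · exact fun r hr => deriv_Psi_nonpos hr

lemma bddAbove_Psi_image : BddAbove (Psi '' Set.Ioi 0) := by
  refine ⟨1, ?_⟩
  rintro _ ⟨r, hr, rfl⟩
  exact (Psi_le_inv_PhiDeriv hr).trans (inv_le_one_of_one_le₀ (one_le_PhiDeriv (le_of_lt hr)))

lemma inv_pow_le_rpow_neg {N r : ℝ} (hr : 1 ≤ r) {n : ℕ} (hn : N ≤ n) :
    (r ^ n)⁻¹ ≤ r ^ (-N) := by
  rw [← Real.rpow_natCast, ← Real.rpow_neg (by linarith)]
  exact Real.rpow_le_rpow_of_exponent_le hr (by linarith)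

/-- (i) `∫_r^∞ Φ(s)^{-2} ds` is finite for `r > 0`;
(ii) `Ψ` is twice differentiable on `(0,∞)` and solves `Ψ'' = Ψ/r`;
(iii) `Ψ` has a positive limit as `r → 0⁺`;
(iv) `Ψ` and `Ψ'` decay faster than any negative power at infinity. -/
theorem stmt9 :
    (∀ r : ℝ, 0 < r → IntegrableOn (fun s => ((Phi s) ^ 2)⁻¹) (Set.Ioi r)) ∧
    (∀ r : ℝ, 0 < r →
      DifferentiableAt ℝ Psi r ∧ DifferentiableAt ℝ (deriv Psi) r ∧
        deriv (deriv Psi) r = Psi r / r) ∧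
    (∃ L : ℝ, 0 < L ∧
      Filter.Tendsto Psi (nhdsWithin 0 (Set.Ioi 0)) (nhds L)) ∧
    (∀ N : ℝ, 0 < N → ∃ C : ℝ, 0 < C ∧ ∀ r : ℝ, 1 ≤ r →
      Psi r ≤ C * r ^ (-N) ∧ |deriv Psi r| ≤ C * r ^ (-N)) := by
  refine ⟨fun r hr => integrableOn_inv_Phi_sq hr, fun r hr =>
    ⟨(hasDerivAt_Psi hr).differentiableAt, (hasDerivAt_deriv_Psi hr).differentiableAt,
      (hasDerivAt_deriv_Psi hr).deriv⟩,
    ⟨_, ?_, antitoneOn_Psi.tendsto_nhdsGT bddAbove_Psi_image⟩, fun N _ => ?_⟩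
  · exact (Psi_pos one_pos).trans_le
      (le_csSup bddAbove_Psi_image (Set.mem_image_of_mem _ (Set.mem_Ioi.2 one_pos)))
  · set n := ⌈N⌉₊
    have hn : N ≤ n := Nat.le_ceil N
    refine ⟨((n : ℝ) + 1) * (Nat.factorial n : ℝ) ^ 2, by positivity, fun r hr => ⟨?_, ?_⟩⟩
    · have hr0 : 0 < r := by linarith
      calc Psi r ≤ (PhiDeriv r)⁻¹ := Psi_le_inv_PhiDeriv hr0
        _ ≤ (r ^ n / (Nat.factorial n : ℝ) ^ 2)⁻¹ :=
          inv_anti₀ (by positivity) (le_PhiDeriv hr0.le n)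
        _ = 1 * (Nat.factorial n : ℝ) ^ 2 * (r ^ n)⁻¹ := by rw [inv_div, one_mul, div_eq_mul_inv]
        _ ≤ _ := by
          gcongr
          · linarith [n.cast_nonneg (α := ℝ)]
          · exact inv_pow_le_rpow_neg hr hn
    · have hr0 : 0 < r := by linarith
      calc |deriv Psi r| ≤ (Phi r)⁻¹ := abs_deriv_Psi_le hr0
        _ ≤ (r ^ (n + 1) / (((n : ℝ) + 1) * (Nat.factorial n : ℝ) ^ 2))⁻¹ :=
          inv_anti₀ (by positivity) (le_Phi hr0.le n)
        _ = ((n : ℝ) + 1) * (Nat.factorial n : ℝ) ^ 2 * (r ^ (n + 1))⁻¹ := by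
          rw [inv_div, div_eq_mul_inv]
        _ ≤ _ := by
          gcongr
          exact inv_pow_le_rpow_neg hr (by push_cast; linarith)
end
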